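/- arXiv:math/0205118 — 9 statements merged into one kernel-verified Lean document; each statement's English description precedes it below -/
import Mathlib

section
/- Let (B₁,B₂,i,j) be an ADHM datum satisfying both ADHM equations (1) and (2). Then (B₁,B₂,i,j) is stable if and only if it is costable. -/
open LinearMap in
theorem adhm_aux {V : Type*} [NormedAddCommGroup V] [InnerProductSpace ℂ V]
    [FiniteDimensional ℂ V] (B : V →ₗ[ℂ] V) (S : Submodule ℂ V) (h : S.map B ≤ S)
    {ι : Type*} [Fintype ι] (e : OrthonormalBasis ι ℂ S) :
    ∑ k, ‖B (e k)‖ ^ 2 + ∑ k, ‖Sᗮ.starProjection (adjoint B (e k))‖ ^ 2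
      = ∑ k, ‖adjoint B (e k)‖ ^ 2 := by
  have h1 : ∀ k, ‖B (e k)‖ ^ 2 = ∑ l, ‖inner ℂ (e l : V) (B (e k))‖ ^ 2 := by
    intro k
    have := e.sum_sq_norm_inner_right ⟨B (e k), h ⟨e k, (e k).2, rfl⟩⟩
    simpa using this.symm
  have h2 : ∀ l, ‖S.starProjection (adjoint B (e l))‖ ^ 2
      = ∑ k, ‖inner ℂ (e l : V) (B (e k))‖ ^ 2 := by
    intro l
    have := e.sum_sq_norm_inner_left (S.orthogonalProjectionOnto (adjoint B (e l)))
    rw [Submodule.starProjection_apply, ← Submodule.coe_norm, ← this]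
    refine Finset.sum_congr rfl fun k _ => ?_
    rw [← adjoint_inner_left, Submodule.inner_orthogonalProjectionOnto_eq_of_mem_right]
  have h3 : ∑ k, ‖B (e k)‖ ^ 2 = ∑ l, ‖S.starProjection (adjoint B (e l))‖ ^ 2 := by
    simp_rw [h1, h2]
    exact Finset.sum_comm
  rw [h3, ← Finset.sum_add_distrib]
  exact Finset.sum_congr rfl fun k _ =>
    (Submodule.norm_sq_eq_add_norm_sq_starProjection _ S).symm

theorem adhm_of_basis {V W : Type*} [NormedAddCommGroup V] [InnerProductSpace ℂ V]
    [NormedAddCommGroup W] [InnerProductSpace ℂ W] (S : Submodule ℂ V)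
    {ι : Type*} [Fintype ι] (e : OrthonormalBasis ι ℂ S) (f : V →ₗ[ℂ] W)
    (h : ∑ k, ‖f (e k)‖ ^ 2 = 0) : ∀ x ∈ S, f x = 0 := by
  have h0 : ∀ k, f (e k) = 0 := by
    intro k
    have := (Finset.sum_eq_zero_iff_of_nonneg (fun k _ => by positivity)).1 h k
      (Finset.mem_univ k)
    simpa using this
  have : f ∘ₗ S.subtype = 0 := e.toBasis.ext fun k => by simpa using h0 k
  intro x hx
  exact LinearMap.congr_fun this ⟨x, hx⟩

open LinearMap in
theorem adhm_key {V W : Type*} [NormedAddCommGroup V] [InnerProductSpace ℂ V]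
    [FiniteDimensional ℂ V]
    [NormedAddCommGroup W] [InnerProductSpace ℂ W] [FiniteDimensional ℂ W]
    (B₁ B₂ : V →ₗ[ℂ] V) (i : W →ₗ[ℂ] V) (j : V →ₗ[ℂ] W)
    (eq2 : B₁ ∘ₗ adjoint B₁ - adjoint B₁ ∘ₗ B₁
         + (B₂ ∘ₗ adjoint B₂ - adjoint B₂ ∘ₗ B₂)
         + i ∘ₗ adjoint i - adjoint j ∘ₗ j = 0)
    (S : Submodule ℂ V) (h₁ : S.map B₁ ≤ S) (h₂ : S.map B₂ ≤ S) (hj : S ≤ ker j) :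
    (∀ x ∈ S, adjoint B₁ x ∈ S) ∧ (∀ x ∈ S, adjoint B₂ x ∈ S) ∧ ∀ x ∈ S, adjoint i x = 0 := by
  have e := stdOrthonormalBasis ℂ S
  have a₁ := adhm_aux B₁ S h₁ e
  have a₂ := adhm_aux B₂ S h₂ e
  have hk : ∀ x ∈ S, ‖adjoint B₁ x‖ ^ 2 - ‖B₁ x‖ ^ 2 + (‖adjoint B₂ x‖ ^ 2 - ‖B₂ x‖ ^ 2)
      + ‖adjoint i x‖ ^ 2 = 0 := by
    intro x hx
    have hjx : j x = 0 := hj hx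
    have q₁ : ∀ B : V →ₗ[ℂ] V, inner ℂ x (B (adjoint B x)) = (‖adjoint B x‖ : ℂ) ^ 2 := by
      intro B
      rw [← adjoint_inner_left]
      exact inner_self_eq_norm_sq_to_K _
    have q₂ : ∀ B : V →ₗ[ℂ] V, inner ℂ x (adjoint B (B x)) = (‖B x‖ : ℂ) ^ 2 := by
      intro B
      rw [adjoint_inner_right]
      exact inner_self_eq_norm_sq_to_K _
    have q₃ : inner ℂ x (i (adjoint i x)) = (‖adjoint i x‖ : ℂ) ^ 2 := by
      rw [← adjoint_inner_left]
      exact inner_self_eq_norm_sq_to_K _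
    have := congrArg (fun y => inner ℂ x y) (LinearMap.congr_fun eq2 x)
    simp only [LinearMap.sub_apply, LinearMap.add_apply, comp_apply, inner_sub_right,
      inner_add_right, hjx, map_zero, LinearMap.zero_apply, inner_zero_right, sub_zero,
      q₁, q₂, q₃] at this
    exact_mod_cast this
  have hs := Finset.sum_congr (rfl : Finset.univ = Finset.univ) fun k _ => hk (e k) (e k).2
  simp only [Finset.sum_add_distrib, Finset.sum_sub_distrib, Finset.sum_const_zero] at hs
  have p₁ : 0 ≤ ∑ k, ‖Sᗮ.starProjection (adjoint B₁ (e k))‖ ^ 2 := by positivity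
  have p₂ : 0 ≤ ∑ k, ‖Sᗮ.starProjection (adjoint B₂ (e k))‖ ^ 2 := by positivity
  have p₃ : 0 ≤ ∑ k, ‖adjoint i (e k)‖ ^ 2 := by positivity
  have fin : ∀ B : V →ₗ[ℂ] V, ∑ k, ‖Sᗮ.starProjection (B (e k))‖ ^ 2 = 0 →
      ∀ x ∈ S, B x ∈ S := by
    intro B hB x hx
    have := adhm_of_basis S e ((Sᗮ.starProjection : V →ₗ[ℂ] V) ∘ₗ B) (by simpa using hB) x hx
    have h4 : Sᗮ.starProjection (B x) = 0 := this
    rw [Submodule.starProjection_apply_eq_zero_iff, Submodule.orthogonal_orthogonal] at h4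
    exact h4
  exact ⟨fin _ (by linarith), fin _ (by linarith), adhm_of_basis S e _ (by linarith)⟩

theorem adhm_orth {V : Type*} [NormedAddCommGroup V] [InnerProductSpace ℂ V]
    [FiniteDimensional ℂ V] (B : V →ₗ[ℂ] V) (S : Submodule ℂ V)
    (h : ∀ x ∈ S, LinearMap.adjoint B x ∈ S) : Sᗮ.map B ≤ Sᗮ := by
  rintro _ ⟨y, hy, rfl⟩ x hx
  rw [← LinearMap.adjoint_inner_left]
  exact hy _ (h x hx)

/-- **Stability ⟺ costability for ADHM data.**
An ADHM datum `(B₁, B₂, i, j)` on finite-dimensional complex inner product spaces `V`, `W`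
satisfying both ADHM equations `[B₁,B₂] + i∘j = 0` and
`[B₁,B₁†] + [B₂,B₂†] + i∘i† − j†∘j = 0` is stable (no proper subspace `S ⊊ V` invariant
under `B₁, B₂` and containing `range i`) if and only if it is costable (no nonzero subspace
`S ⊆ V` invariant under `B₁, B₂` and contained in `ker j`). -/
theorem adhm_stable_iff_costable
    {V W : Type*} [NormedAddCommGroup V] [InnerProductSpace ℂ V] [FiniteDimensional ℂ V]
    [NormedAddCommGroup W] [InnerProductSpace ℂ W] [FiniteDimensional ℂ W]
    (B₁ B₂ : V →ₗ[ℂ] V) (i : W →ₗ[ℂ] V) (j : V →ₗ[ℂ] W)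
    (eq1 : B₁ ∘ₗ B₂ - B₂ ∘ₗ B₁ + i ∘ₗ j = 0)
    (eq2 : B₁ ∘ₗ LinearMap.adjoint B₁ - LinearMap.adjoint B₁ ∘ₗ B₁
         + (B₂ ∘ₗ LinearMap.adjoint B₂ - LinearMap.adjoint B₂ ∘ₗ B₂)
         + i ∘ₗ LinearMap.adjoint i - LinearMap.adjoint j ∘ₗ j = 0) :
    (¬ ∃ S : Submodule ℂ V, S ≠ ⊤ ∧ S.map B₁ ≤ S ∧ S.map B₂ ≤ S ∧ LinearMap.range i ≤ S)
      ↔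
    (¬ ∃ S : Submodule ℂ V, S ≠ ⊥ ∧ S.map B₁ ≤ S ∧ S.map B₂ ≤ S ∧ S ≤ LinearMap.ker j) := by
  rw [not_iff_not]
  constructor
  · rintro ⟨S, hS, h₁, h₂, hi⟩
    have k₁ : Sᗮ.map (LinearMap.adjoint B₁) ≤ Sᗮ := adhm_orth _ S fun x hx => by
      rw [LinearMap.adjoint_adjoint]; exact h₁ ⟨x, hx, rfl⟩
    have k₂ : Sᗮ.map (LinearMap.adjoint B₂) ≤ Sᗮ := adhm_orth _ S fun x hx => by
      rw [LinearMap.adjoint_adjoint]; exact h₂ ⟨x, hx, rfl⟩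
    have ki : Sᗮ ≤ LinearMap.ker (LinearMap.adjoint i) := by
      intro x hx
      rw [LinearMap.mem_ker, ← inner_self_eq_zero (𝕜 := ℂ), LinearMap.adjoint_inner_right]
      exact hx _ (hi ⟨_, rfl⟩)
    obtain ⟨r₁, r₂, r₃⟩ := adhm_key (LinearMap.adjoint B₁) (LinearMap.adjoint B₂)
      (LinearMap.adjoint j) (LinearMap.adjoint i) (by
        simp only [LinearMap.adjoint_adjoint]
        rw [← neg_eq_zero, ← eq2]
        abel) Sᗮ k₁ k₂ ki
    simp only [LinearMap.adjoint_adjoint] at r₁ r₂ r₃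
    refine ⟨Sᗮ, fun h => hS (Submodule.orthogonal_eq_bot_iff.1 h), ?_, ?_, r₃⟩
    · rintro _ ⟨x, hx, rfl⟩; exact r₁ x hx
    · rintro _ ⟨x, hx, rfl⟩; exact r₂ x hx
  · rintro ⟨S, hS, h₁, h₂, hj⟩
    obtain ⟨r₁, r₂, r₃⟩ := adhm_key B₁ B₂ i j eq2 S h₁ h₂ hj
    refine ⟨Sᗮ, fun h => hS ?_, adhm_orth _ S r₁, adhm_orth _ S r₂, ?_⟩
    · rw [← Submodule.orthogonal_orthogonal S, h, Submodule.top_orthogonal_eq_bot]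
    · rintro _ ⟨w, rfl⟩ x hx
      rw [← LinearMap.adjoint_inner_left, r₃ x hx, inner_zero_left]
end

section
/- Let V be a finite-dimensional complex inner product space, B : V → V a linear map, and T ⊆ V a subspace with B†(T) ⊆ T. Let P denote the orthogonal projection of V onto T. Then Tr(P∘(B∘B† − B†∘B)∘P) = −Tr((B∘P − P∘B∘P)†∘(B∘P − P∘B∘P)); in particular this trace is a nonpositive real number. -/
/-- Let `V` be a finite-dimensional complex inner product space, `B : V → V` linear, and
`T ⊆ V` a subspace with `B†(T) ⊆ T`. Let `P` be the orthogonal projection of `V` onto `T`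
(i.e. the self-adjoint idempotent with range `T`). Then
`Tr(P∘(B∘B† − B†∘B)∘P) = −Tr((B∘P − P∘B∘P)† ∘ (B∘P − P∘B∘P))`;
in particular this trace is a nonpositive real number. -/
theorem trace_commutator_proj_nonpos
    {V : Type*} [NormedAddCommGroup V] [InnerProductSpace ℂ V] [FiniteDimensional ℂ V]
    (B : V →ₗ[ℂ] V) (T : Submodule ℂ V)
    (hT : T.map (LinearMap.adjoint B) ≤ T)
    (P : V →ₗ[ℂ] V)
    (hP_sa : LinearMap.adjoint P = P)
    (hP_idem : P ∘ₗ P = P)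
    (hP_range : LinearMap.range P = T) :
    LinearMap.trace ℂ V
        (P ∘ₗ (B ∘ₗ LinearMap.adjoint B - LinearMap.adjoint B ∘ₗ B) ∘ₗ P)
      = - LinearMap.trace ℂ V
          (LinearMap.adjoint (B ∘ₗ P - P ∘ₗ B ∘ₗ P) ∘ₗ (B ∘ₗ P - P ∘ₗ B ∘ₗ P))
    ∧ ∃ r : ℝ, r ≤ 0 ∧
        LinearMap.trace ℂ V
            (P ∘ₗ (B ∘ₗ LinearMap.adjoint B - LinearMap.adjoint B ∘ₗ B) ∘ₗ P) = (r : ℂ) := by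
  set C := LinearMap.adjoint B with hC
  have hCB : LinearMap.adjoint C = B := LinearMap.adjoint_adjoint B
  have h1 : P ∘ₗ C ∘ₗ P = C ∘ₗ P := by
    ext x
    have hx : C (P x) ∈ T := hT ⟨P x, hP_range ▸ ⟨x, rfl⟩, rfl⟩
    rw [← hP_range] at hx
    obtain ⟨y, hy⟩ := hx
    have := LinearMap.congr_fun hP_idem y
    simp only [LinearMap.comp_apply] at this ⊢
    rw [← hy, this]
  have h2 : P ∘ₗ B ∘ₗ P = P ∘ₗ B := by
    have := congrArg LinearMap.adjoint h1
    simpa only [LinearMap.adjoint_comp, hP_sa, hCB, LinearMap.comp_assoc] using this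
  have hD : LinearMap.adjoint (B ∘ₗ P - P ∘ₗ B ∘ₗ P) = P ∘ₗ C - P ∘ₗ C ∘ₗ P := by
    simp only [map_sub, LinearMap.adjoint_comp, hP_sa, ← hC, LinearMap.comp_assoc]
  have key : LinearMap.trace ℂ V (P ∘ₗ (B ∘ₗ C - C ∘ₗ B) ∘ₗ P)
      = - LinearMap.trace ℂ V
          (LinearMap.adjoint (B ∘ₗ P - P ∘ₗ B ∘ₗ P) ∘ₗ (B ∘ₗ P - P ∘ₗ B ∘ₗ P)) := by
    rw [hD]
    simp only [← Module.End.mul_eq_comp] at h1 h2 hP_idem ⊢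
    have e1 : P * ((B * C - C * B) * P) = (P * B) * (C * P) - P * C * B * P := by noncomm_ring
    have e2 : (P * C - P * (C * P)) * (B * P - P * (B * P))
        = P * C * B * P - (C * P) * (P * B) := by
      rw [h1, h2]
      have : C * P * (B * P) = C * P * (P * B) := by
        rw [← h2, ← mul_assoc (C * P) P, mul_assoc C P P, hP_idem]
      have h3 : P * C * (P * B) = C * P * (P * B) := by
        calc P * C * (P * B) = P * C * ((P * P) * B) := by rw [hP_idem]
          _ = (P * (C * P)) * (P * B) := by noncomm_ring
          _ = _ := by rw [h1]
      rw [sub_mul, mul_sub, mul_sub, this, h3]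
      noncomm_ring
    rw [e1, e2, map_sub, map_sub, LinearMap.trace_mul_comm ℂ (P * B)]
    ring
  refine ⟨key, ?_⟩
  rw [key]
  generalize B ∘ₗ P - P ∘ₗ B ∘ₗ P = D
  let b := stdOrthonormalBasis ℂ V
  refine ⟨-∑ i, ‖D (b i)‖ ^ 2, neg_nonpos.2 (Finset.sum_nonneg fun i _ => by positivity), ?_⟩
  rw [LinearMap.trace_eq_sum_inner _ b]
  push_cast
  congr 1
  refine Finset.sum_congr rfl fun i _ => ?_
  rw [Function.comp_apply, LinearMap.adjoint_inner_right]
  exact inner_self_eq_norm_sq_to_K _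
end

section
/- Let (B₁,B₂,i,j) be an ADHM datum satisfying ADHM equation (2). If T ⊆ V is a subspace with B₁†(T) ⊆ T, B₂†(T) ⊆ T and T ⊆ ker(i†), then T ⊆ ker(j). -/
open LinearMap in
theorem adhm_aux_s2 {V : Type*} [NormedAddCommGroup V] [InnerProductSpace ℂ V]
    [FiniteDimensional ℂ V] (B : V →ₗ[ℂ] V) (T : Submodule ℂ V)
    (hT : T.map (LinearMap.adjoint B) ≤ T) {n : ℕ} (e : OrthonormalBasis (Fin n) ℂ T) :
    ∑ k, ‖LinearMap.adjoint B (e k : V)‖ ^ 2 ≤ ∑ k, ‖B (e k : V)‖ ^ 2 := by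
  have ho : Orthonormal ℂ (fun k => (e k : V)) :=
    e.orthonormal.comp_linearIsometry T.subtypeₗᵢ
  have h1 : ∀ k, ‖LinearMap.adjoint B (e k : V)‖ ^ 2
      = ∑ l, ‖inner ℂ (e k : V) (B (e l : V))‖ ^ 2 := by
    intro k
    have hm : LinearMap.adjoint B (e k : V) ∈ T := hT ⟨_, (e k).2, rfl⟩
    have := e.sum_sq_norm_inner_right ⟨_, hm⟩
    rw [Submodule.coe_norm] at this
    rw [← this]
    refine Finset.sum_congr rfl fun l _ => ?_
    rw [Submodule.coe_inner, LinearMap.adjoint_inner_right, norm_inner_symm]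
  rw [Finset.sum_congr rfl fun k _ => h1 k, Finset.sum_comm]
  exact Finset.sum_le_sum fun l _ => ho.sum_inner_products_le (B (e l : V))

/-- Let `(B₁,B₂,i,j)` be an ADHM datum satisfying ADHM equation (2):
`[B₁,B₁†] + [B₂,B₂†] + i∘i† − j†∘j = 0`. If `T ⊆ V` is a subspace with
`B₁†(T) ⊆ T`, `B₂†(T) ⊆ T` and `T ⊆ ker(i†)`, then `T ⊆ ker j`. -/
theorem adhm_eq2_subspace_ker_j
    {V W : Type*} [NormedAddCommGroup V] [InnerProductSpace ℂ V] [FiniteDimensional ℂ V]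
    [NormedAddCommGroup W] [InnerProductSpace ℂ W] [FiniteDimensional ℂ W]
    (B₁ B₂ : V →ₗ[ℂ] V) (i : W →ₗ[ℂ] V) (j : V →ₗ[ℂ] W)
    (eq2 : B₁ ∘ₗ LinearMap.adjoint B₁ - LinearMap.adjoint B₁ ∘ₗ B₁
         + (B₂ ∘ₗ LinearMap.adjoint B₂ - LinearMap.adjoint B₂ ∘ₗ B₂)
         + i ∘ₗ LinearMap.adjoint i - LinearMap.adjoint j ∘ₗ j = 0)
    (T : Submodule ℂ V)
    (hT₁ : T.map (LinearMap.adjoint B₁) ≤ T)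
    (hT₂ : T.map (LinearMap.adjoint B₂) ≤ T)
    (hTi : T ≤ LinearMap.ker (LinearMap.adjoint i)) :
    T ≤ LinearMap.ker j := by
  have e := stdOrthonormalBasis ℂ T
  have key : ∀ x ∈ T, ‖LinearMap.adjoint B₁ x‖ ^ 2 - ‖B₁ x‖ ^ 2
      + (‖LinearMap.adjoint B₂ x‖ ^ 2 - ‖B₂ x‖ ^ 2) = ‖j x‖ ^ 2 := by
    intro x hx
    have hi : LinearMap.adjoint i x = 0 := hTi hx
    have h := congrArg (fun f : V →ₗ[ℂ] V => inner ℂ x (f x)) eq2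
    simp only [LinearMap.sub_apply, LinearMap.add_apply, LinearMap.comp_apply, hi, map_zero,
      LinearMap.zero_apply, inner_sub_right, inner_add_right, inner_zero_right,
      LinearMap.adjoint_inner_right] at h
    simp only [← LinearMap.adjoint_inner_left, inner_self_eq_norm_sq_to_K] at h
    have h' := congrArg Complex.re h
    norm_cast at h'
    simp at h'
    norm_cast at h'
    linarith
  have a1 := adhm_aux_s2 B₁ T hT₁ e
  have a2 := adhm_aux_s2 B₂ T hT₂ e
  have hs : ∑ k, ‖j (e k : V)‖ ^ 2 ≤ 0 := by
    rw [← Finset.sum_congr rfl fun k _ => key (e k : V) (e k).2]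
    simp only [Finset.sum_add_distrib, Finset.sum_sub_distrib]
    linarith
  have h0 : ∀ k, j (e k : V) = 0 := by
    intro k
    have := (Finset.sum_eq_zero_iff_of_nonneg (fun k _ => sq_nonneg ‖j (e k : V)‖)).1
      (le_antisymm hs (Finset.sum_nonneg fun k _ => sq_nonneg _)) k (Finset.mem_univ k)
    simpa using this
  have hz : j ∘ₗ T.subtype = 0 := e.toBasis.ext fun k => by simpa using h0 k
  intro x hx
  exact LinearMap.congr_fun hz ⟨x, hx⟩
end

section
/- Let (B₁,B₂,i,j) be an ADHM datum satisfying both ADHM equations (1) and (2). Then the R-module map β : (V ⊕ V ⊕ W) ⊗ R → V ⊗ R is surjective if and only if the datum is stable. -/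
open scoped TensorProduct

/-- Let `(B₁,B₂,i,j)` be an ADHM datum satisfying both ADHM equations. Then the `R`-module
map `β : (V ⊕ V ⊕ W) ⊗ R → V ⊗ R`,
`β(v₁⊗f₁, v₂⊗f₂, w⊗f₃) = −B₂v₁⊗f₁ + v₁⊗z₂f₁ + B₁v₂⊗f₂ − v₂⊗z₁f₂ + i(w)⊗f₃`,
over the polynomial ring `R = ℂ[z₁,z₂]`, is surjective if and only if the datum is stable. -/
theorem adhm_beta_surjective_iff_stable
    {V W : Type*} [NormedAddCommGroup V] [InnerProductSpace ℂ V] [FiniteDimensional ℂ V]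
    [NormedAddCommGroup W] [InnerProductSpace ℂ W] [FiniteDimensional ℂ W]
    (B₁ B₂ : V →ₗ[ℂ] V) (i : W →ₗ[ℂ] V) (j : V →ₗ[ℂ] W)
    (eq1 : B₁ ∘ₗ B₂ - B₂ ∘ₗ B₁ + i ∘ₗ j = 0)
    (eq2 : B₁ ∘ₗ LinearMap.adjoint B₁ - LinearMap.adjoint B₁ ∘ₗ B₁
         + (B₂ ∘ₗ LinearMap.adjoint B₂ - LinearMap.adjoint B₂ ∘ₗ B₂)
         + i ∘ₗ LinearMap.adjoint i - LinearMap.adjoint j ∘ₗ j = 0)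
    (β : (V ⊗[ℂ] MvPolynomial (Fin 2) ℂ) × (V ⊗[ℂ] MvPolynomial (Fin 2) ℂ) ×
          (W ⊗[ℂ] MvPolynomial (Fin 2) ℂ) →ₗ[ℂ] V ⊗[ℂ] MvPolynomial (Fin 2) ℂ)
    (hβ : ∀ (v₁ v₂ : V) (w : W) (f₁ f₂ f₃ : MvPolynomial (Fin 2) ℂ),
      β (v₁ ⊗ₜ f₁, v₂ ⊗ₜ f₂, w ⊗ₜ f₃) =
        - (B₂ v₁ ⊗ₜ f₁) + v₁ ⊗ₜ (MvPolynomial.X 1 * f₁)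
        + B₁ v₂ ⊗ₜ f₂ - v₂ ⊗ₜ (MvPolynomial.X 0 * f₂)
        + i w ⊗ₜ f₃) :
    Function.Surjective β ↔
      (¬ ∃ S : Submodule ℂ V, S ≠ ⊤ ∧ S.map B₁ ≤ S ∧ S.map B₂ ≤ S ∧ LinearMap.range i ≤ S) := by
  have h1 : ∀ v f, β (v ⊗ₜ f, 0, 0) = - (B₂ v ⊗ₜ f) + v ⊗ₜ (MvPolynomial.X 1 * f) := by
    intro v f
    simpa using hβ v 0 0 f 0 0
  have h2 : ∀ v f, β (0, v ⊗ₜ f, 0) = B₁ v ⊗ₜ f - v ⊗ₜ (MvPolynomial.X 0 * f) := by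
    intro v f
    simpa using hβ 0 v 0 0 f 0
  have h3 : ∀ w f, β (0, 0, w ⊗ₜ f) = i w ⊗ₜ f := by
    intro w f
    simpa using hβ 0 0 w 0 0 f
  constructor
  · rintro hs ⟨S, hS, hB1, hB2, hi⟩
    rw [Submodule.map_le_iff_le_comap] at hB1 hB2
    let C₁ : Module.End ℂ (V ⧸ S) := S.mapQ S B₁ hB1
    let C₂ : Module.End ℂ (V ⧸ S) := S.mapQ S B₂ hB2
    have hC1 : ∀ v, C₁ (S.mkQ v) = S.mkQ (B₁ v) := fun v => rfl
    have hC2 : ∀ v, C₂ (S.mkQ v) = S.mkQ (B₂ v) := fun v => rfl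
    have hcomm : Commute C₁ C₂ := by
      apply LinearMap.ext
      intro q
      obtain ⟨v, rfl⟩ := S.mkQ_surjective q
      rw [Module.End.mul_apply, Module.End.mul_apply, hC1, hC2, hC1, hC2, ← sub_eq_zero,
        ← map_sub]
      have h := LinearMap.congr_fun eq1 v
      simp only [LinearMap.add_apply, LinearMap.sub_apply, LinearMap.comp_apply,
        LinearMap.zero_apply] at h
      rw [eq_neg_of_add_eq_zero_left h]
      simpa using hi ⟨j v, rfl⟩
    let E : MvPolynomial (Fin 2) ℂ →ₗ[ℂ] Module.End ℂ (V ⧸ S) :=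
      (MvPolynomial.basisMonomials (Fin 2) ℂ).constr ℂ (fun m => C₁ ^ (m 0) * C₂ ^ (m 1))
    have hE : ∀ m, E (MvPolynomial.monomial m 1) = C₁ ^ (m 0) * C₂ ^ (m 1) := by
      intro m
      have := (MvPolynomial.basisMonomials (Fin 2) ℂ).constr_basis ℂ
        (fun m => C₁ ^ (m 0) * C₂ ^ (m 1)) m
      simpa only [MvPolynomial.coe_basisMonomials] using this
    have hE1 : ∀ f, E (MvPolynomial.X 0 * f) = E f * C₁ := by
      intro f
      have : E ∘ₗ LinearMap.mulLeft ℂ (MvPolynomial.X 0) = LinearMap.mulRight ℂ C₁ ∘ₗ E := by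
        apply (MvPolynomial.basisMonomials (Fin 2) ℂ).ext
        intro m
        simp only [MvPolynomial.coe_basisMonomials, LinearMap.comp_apply,
          LinearMap.mulLeft_apply, LinearMap.mulRight_apply, hE, MvPolynomial.X,
          MvPolynomial.monomial_mul, mul_one]
        simp only [Finsupp.add_apply, Finsupp.single_apply]
        simp only [if_true, Fin.isValue, zero_ne_one, if_false, zero_add, add_comm 1, pow_succ]
        rw [mul_assoc, mul_assoc, (hcomm.pow_right _).eq]
      exact LinearMap.congr_fun this f
    have hE2 : ∀ f, E (MvPolynomial.X 1 * f) = E f * C₂ := by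
      intro f
      have : E ∘ₗ LinearMap.mulLeft ℂ (MvPolynomial.X 1) = LinearMap.mulRight ℂ C₂ ∘ₗ E := by
        apply (MvPolynomial.basisMonomials (Fin 2) ℂ).ext
        intro m
        simp only [MvPolynomial.coe_basisMonomials, LinearMap.comp_apply,
          LinearMap.mulLeft_apply, LinearMap.mulRight_apply, hE, MvPolynomial.X,
          MvPolynomial.monomial_mul, mul_one]
        simp only [Finsupp.add_apply, Finsupp.single_apply]
        simp only [if_true, Fin.isValue, one_ne_zero, if_false, zero_add, add_comm 1, pow_succ]
        rw [mul_assoc]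
      exact LinearMap.congr_fun this f
    let Φ : V ⊗[ℂ] MvPolynomial (Fin 2) ℂ →ₗ[ℂ] V ⧸ S :=
      TensorProduct.lift (E.flip ∘ₗ S.mkQ)
    have hΦ : ∀ v f, Φ (v ⊗ₜ f) = E f (S.mkQ v) := fun v f => rfl
    have hz : Φ ∘ₗ β = 0 := by
      apply LinearMap.prod_ext
      · apply TensorProduct.ext'
        intro v f
        simp only [LinearMap.comp_apply, LinearMap.inl_apply, LinearMap.zero_apply]
        change Φ (β (v ⊗ₜ f, 0, 0)) = 0
        rw [h1, map_add, map_neg, hΦ, hΦ, hE2, Module.End.mul_apply, hC2, neg_add_cancel]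
      apply LinearMap.prod_ext
      · apply TensorProduct.ext'
        intro v f
        change Φ (β (0, v ⊗ₜ f, 0)) = 0
        rw [h2, map_sub, hΦ, hΦ, hE1, Module.End.mul_apply, hC1, sub_self]
      · apply TensorProduct.ext'
        intro w f
        change Φ (β (0, 0, w ⊗ₜ f)) = 0
        have : S.mkQ (i w) = 0 := by simpa using hi ⟨w, rfl⟩
        rw [h3, hΦ, this, map_zero]
    apply hS
    rw [eq_top_iff]
    intro v _
    obtain ⟨x, hx⟩ := hs (v ⊗ₜ 1)
    have h := LinearMap.congr_fun hz x
    rw [LinearMap.comp_apply, hx, hΦ] at h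
    have e1 : E 1 = 1 := by simpa using hE 0
    rw [e1] at h
    simpa using h
  · intro hst
    let S : Submodule ℂ V :=
      { carrier := {v | ∀ f, v ⊗ₜ f ∈ LinearMap.range β}
        zero_mem' := fun f => by rw [TensorProduct.zero_tmul]; exact zero_mem _
        add_mem' := fun ha hb f => by
          rw [TensorProduct.add_tmul]; exact add_mem (ha f) (hb f)
        smul_mem' := fun c v hv f => by
          rw [← TensorProduct.smul_tmul']; exact Submodule.smul_mem _ c (hv f) }
    have hS : S = ⊤ := by
      by_contra hne
      refine hst ⟨S, hne, ?_, ?_, ?_⟩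
      · rintro _ ⟨v, hv, rfl⟩ f
        have := add_mem (LinearMap.mem_range_self β (0, v ⊗ₜ f, 0)) (hv (MvPolynomial.X 0 * f))
        rwa [h2, sub_add_cancel] at this
      · rintro _ ⟨v, hv, rfl⟩ f
        have := sub_mem (hv (MvPolynomial.X 1 * f)) (LinearMap.mem_range_self β (v ⊗ₜ f, 0, 0))
        rwa [h1, neg_add_eq_sub, sub_sub_cancel] at this
      · rintro _ ⟨w, rfl⟩ f
        exact ⟨_, h3 w f⟩
    intro x
    change x ∈ LinearMap.range β
    induction x with
    | zero => exact zero_mem _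
    | add a b ha hb => exact add_mem ha hb
    | tmul v f =>
      have : v ∈ S := hS ▸ Submodule.mem_top
      exact this f
end

section
/- Let (B₁,B₂,i,j) be an ADHM datum satisfying both ADHM equations (1) and (2). Then the R'-module map αᵈ : (V ⊕ V ⊕ W) ⊗ R' → V ⊗ R' is surjective if and only if the datum is costable. -/
open scoped TensorProduct

theorem adhm_exists_eig {V : Type*} [AddCommGroup V] [Module ℂ V] [FiniteDimensional ℂ V]
    (B : V →ₗ[ℂ] V) (S : Submodule ℂ V) (hS : S ≠ ⊥) (h : ∀ x ∈ S, B x ∈ S) :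
    ∃ (a : ℂ) (v : V), v ∈ S ∧ v ≠ 0 ∧ B v = a • v := by
  haveI : Nontrivial S := Submodule.nontrivial_iff_ne_bot.mpr hS
  obtain ⟨a, ha⟩ := Module.End.exists_eigenvalue (B.restrict h)
  obtain ⟨v, hv⟩ := ha.exists_hasEigenvector
  refine ⟨a, v, v.2, fun h0 => hv.2 (Subtype.ext h0), ?_⟩
  have := congrArg Subtype.val hv.apply_eq_smul
  simpa using this

theorem adhm_joint_eig {V : Type*} [AddCommGroup V] [Module ℂ V] [FiniteDimensional ℂ V]
    (B C : V →ₗ[ℂ] V) (S : Submodule ℂ V) (hS : S ≠ ⊥) (hB : ∀ x ∈ S, B x ∈ S)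
    (hC : ∀ x ∈ S, C x ∈ S) (hBC : ∀ x ∈ S, B (C x) = C (B x)) :
    ∃ (a b : ℂ) (v : V), v ∈ S ∧ v ≠ 0 ∧ B v = a • v ∧ C v = b • v := by
  obtain ⟨a, v, hv, hv0, hav⟩ := adhm_exists_eig B S hS hB
  obtain ⟨b, u, hu, hu0, hbu⟩ := adhm_exists_eig C (S ⊓ Module.End.eigenspace B a)
    (fun h => hv0 (by
      have : v ∈ S ⊓ Module.End.eigenspace B a := ⟨hv, Module.End.mem_eigenspace_iff.mpr hav⟩
      rw [h] at this
      simpa using this))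
    (fun x hx => ⟨hC x hx.1, Module.End.mem_eigenspace_iff.mpr (by
      rw [hBC x hx.1, Module.End.mem_eigenspace_iff.mp hx.2, map_smul])⟩)
  exact ⟨a, b, u, hu.1, hu0, Module.End.mem_eigenspace_iff.mp hu.2, hbu⟩

/-- Let `(B₁,B₂,i,j)` be an ADHM datum satisfying both ADHM equations. Then the `R'`-module
map `αd : (V ⊕ V ⊕ W) ⊗ R' → V ⊗ R'`,
`αd(v₁⊗f₁, v₂⊗f₂, w⊗f₃) = B₁†v₁⊗f₁ + v₁⊗w₂f₁ + B₂†v₂⊗f₂ − v₂⊗w₁f₂ + j†(w)⊗f₃`,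
over the polynomial ring `R' = ℂ[w₁,w₂]`, is surjective if and only if the datum is
costable. -/
theorem adhm_alpha_dual_surjective_iff_costable
    {V W : Type*} [NormedAddCommGroup V] [InnerProductSpace ℂ V] [FiniteDimensional ℂ V]
    [NormedAddCommGroup W] [InnerProductSpace ℂ W] [FiniteDimensional ℂ W]
    (B₁ B₂ : V →ₗ[ℂ] V) (i : W →ₗ[ℂ] V) (j : V →ₗ[ℂ] W)
    (eq1 : B₁ ∘ₗ B₂ - B₂ ∘ₗ B₁ + i ∘ₗ j = 0)
    (eq2 : B₁ ∘ₗ LinearMap.adjoint B₁ - LinearMap.adjoint B₁ ∘ₗ B₁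
         + (B₂ ∘ₗ LinearMap.adjoint B₂ - LinearMap.adjoint B₂ ∘ₗ B₂)
         + i ∘ₗ LinearMap.adjoint i - LinearMap.adjoint j ∘ₗ j = 0)
    (αd : (V ⊗[ℂ] MvPolynomial (Fin 2) ℂ) × (V ⊗[ℂ] MvPolynomial (Fin 2) ℂ) ×
          (W ⊗[ℂ] MvPolynomial (Fin 2) ℂ) →ₗ[ℂ] V ⊗[ℂ] MvPolynomial (Fin 2) ℂ)
    (hαd : ∀ (v₁ v₂ : V) (w : W) (f₁ f₂ f₃ : MvPolynomial (Fin 2) ℂ),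
      αd (v₁ ⊗ₜ f₁, v₂ ⊗ₜ f₂, w ⊗ₜ f₃) =
        LinearMap.adjoint B₁ v₁ ⊗ₜ f₁ + v₁ ⊗ₜ (MvPolynomial.X 1 * f₁)
        + LinearMap.adjoint B₂ v₂ ⊗ₜ f₂ - v₂ ⊗ₜ (MvPolynomial.X 0 * f₂)
        + LinearMap.adjoint j w ⊗ₜ f₃) :
    Function.Surjective αd ↔
      (¬ ∃ S : Submodule ℂ V, S ≠ ⊥ ∧ S.map B₁ ≤ S ∧ S.map B₂ ≤ S ∧ S ≤ LinearMap.ker j) := by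
  have h1 : ∀ (v : V) (f : MvPolynomial (Fin 2) ℂ), αd (v ⊗ₜ f, 0, 0) =
      LinearMap.adjoint B₁ v ⊗ₜ f + v ⊗ₜ (MvPolynomial.X 1 * f) := fun v f => by
    simpa using hαd v 0 0 f 0 0
  have h2 : ∀ (v : V) (f : MvPolynomial (Fin 2) ℂ), αd (0, v ⊗ₜ f, 0) =
      LinearMap.adjoint B₂ v ⊗ₜ f - v ⊗ₜ (MvPolynomial.X 0 * f) := fun v f => by
    simpa using hαd 0 v 0 0 f 0
  have h3 : ∀ (w : W) (f : MvPolynomial (Fin 2) ℂ), αd (0, 0, w ⊗ₜ f) =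
      LinearMap.adjoint j w ⊗ₜ f := fun w f => by
    simpa using hαd 0 0 w 0 0 f
  constructor
  · rintro hsurj ⟨S, hS, hS1, hS2, hSj⟩
    obtain ⟨a, b, v, hvS, hv0, hav, hbv⟩ := adhm_joint_eig B₁ B₂ S hS
      (fun x hx => hS1 (Submodule.mem_map_of_mem hx))
      (fun x hx => hS2 (Submodule.mem_map_of_mem hx))
      (fun x hx => by
        have h := LinearMap.congr_fun eq1 x
        have hj : j x = 0 := hSj hx
        simp [hj] at h
        exact sub_eq_zero.mp h)
    have hjv : j v = 0 := hSj hvS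
    let ev : MvPolynomial (Fin 2) ℂ →ₐ[ℂ] ℂ :=
      MvPolynomial.aeval ![starRingEnd ℂ b, -starRingEnd ℂ a]
    let φ : V ⊗[ℂ] MvPolynomial (Fin 2) ℂ →ₗ[ℂ] ℂ :=
      LinearMap.mul' ℂ ℂ ∘ₗ TensorProduct.map (innerₛₗ ℂ v) ev.toLinearMap
    have hφ : ∀ u f, φ (u ⊗ₜ f) = inner ℂ v u * ev f := fun u f => by simp [φ]
    have hX0 : ev (MvPolynomial.X 0) = starRingEnd ℂ b := by simp [ev]
    have hX1 : ev (MvPolynomial.X 1) = -starRingEnd ℂ a := by simp [ev]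
    have hz : φ ∘ₗ αd = 0 := by
      apply LinearMap.prod_ext
      · apply TensorProduct.ext'
        intro u f
        simp only [LinearMap.comp_apply, LinearMap.inl_apply, LinearMap.zero_apply]
        rw [show ((0 : (V ⊗[ℂ] MvPolynomial (Fin 2) ℂ) × (W ⊗[ℂ] MvPolynomial (Fin 2) ℂ))) = (0, 0)
          from rfl, h1, map_add, hφ, hφ, map_mul, hX1, LinearMap.adjoint_inner_right, hav,
          inner_smul_left]
        ring
      · apply LinearMap.prod_ext
        · apply TensorProduct.ext'
          intro u f
          simp only [LinearMap.comp_apply, LinearMap.inl_apply, LinearMap.inr_apply,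
            LinearMap.zero_apply]
          rw [h2, map_sub, hφ, hφ, map_mul, hX0, LinearMap.adjoint_inner_right, hbv,
            inner_smul_left]
          ring
        · apply TensorProduct.ext'
          intro u f
          simp only [LinearMap.comp_apply, LinearMap.inr_apply, LinearMap.zero_apply]
          rw [h3, hφ, LinearMap.adjoint_inner_right, hjv, inner_zero_left, zero_mul]
    obtain ⟨y, hy⟩ := hsurj (v ⊗ₜ 1)
    have h := LinearMap.congr_fun hz y
    rw [LinearMap.comp_apply, hy, hφ] at h
    simp [hv0] at h
  · intro hco
    let M : MvPolynomial (Fin 2) ℂ →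
      V ⊗[ℂ] MvPolynomial (Fin 2) ℂ →ₗ[ℂ] V ⊗[ℂ] MvPolynomial (Fin 2) ℂ :=
      fun p => LinearMap.lTensor V (LinearMap.mulLeft ℂ p)
    let MW : MvPolynomial (Fin 2) ℂ →
      W ⊗[ℂ] MvPolynomial (Fin 2) ℂ →ₗ[ℂ] W ⊗[ℂ] MvPolynomial (Fin 2) ℂ :=
      fun p => LinearMap.lTensor W (LinearMap.mulLeft ℂ p)
    have hM : ∀ p (v : V) f, M p (v ⊗ₜ f) = v ⊗ₜ (p * f) := fun p v f => by simp [M]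
    have hMW : ∀ p (v : W) f, MW p (v ⊗ₜ f) = v ⊗ₜ (p * f) := fun p v f => by simp [MW]
    have hcomm : ∀ p, M p ∘ₗ αd = αd ∘ₗ ((M p).prodMap ((M p).prodMap (MW p))) := by
      intro p
      apply LinearMap.prod_ext
      · apply TensorProduct.ext'
        intro u f
        simp only [LinearMap.comp_apply, LinearMap.inl_apply, LinearMap.prodMap_apply, hM, map_zero]
        rw [show ((0 : (V ⊗[ℂ] MvPolynomial (Fin 2) ℂ) × (W ⊗[ℂ] MvPolynomial (Fin 2) ℂ))) = (0, 0)
          from rfl, h1, h1, map_add, hM, hM, mul_left_comm]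
      · apply LinearMap.prod_ext
        · apply TensorProduct.ext'
          intro u f
          simp only [LinearMap.comp_apply, LinearMap.inl_apply, LinearMap.inr_apply,
            LinearMap.prodMap_apply, hM, map_zero]
          rw [h2, h2, map_sub, hM, hM, mul_left_comm]
        · apply TensorProduct.ext'
          intro u f
          simp only [LinearMap.comp_apply, LinearMap.inr_apply,
            LinearMap.prodMap_apply, hMW, map_zero]
          rw [h3, h3, hM]
    have hmul : ∀ p (v : V) f, v ⊗ₜ f ∈ LinearMap.range αd →
        v ⊗ₜ (p * f) ∈ LinearMap.range αd := by
      rintro p v f ⟨y, hy⟩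
      refine ⟨_, (LinearMap.congr_fun (hcomm p) y).symm.trans ?_⟩
      rw [LinearMap.comp_apply, hy, hM]
    let K : Submodule ℂ V := (LinearMap.range αd).comap
      ((TensorProduct.mk ℂ V (MvPolynomial (Fin 2) ℂ)).flip 1)
    have hK : ∀ v, v ∈ K ↔ v ⊗ₜ[ℂ] (1 : MvPolynomial (Fin 2) ℂ) ∈ LinearMap.range αd :=
      fun v => Iff.rfl
    have hK1 : ∀ v ∈ K, LinearMap.adjoint B₁ v ∈ K := by
      intro v hv
      have := (LinearMap.range αd).sub_mem ⟨_, h1 v 1⟩ (hmul (MvPolynomial.X 1) v 1 hv)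
      rwa [add_sub_cancel_right] at this
    have hK2 : ∀ v ∈ K, LinearMap.adjoint B₂ v ∈ K := by
      intro v hv
      have := (LinearMap.range αd).add_mem ⟨_, h2 v 1⟩ (hmul (MvPolynomial.X 0) v 1 hv)
      rwa [sub_add_cancel] at this
    have hKj : ∀ w, LinearMap.adjoint j w ∈ K := fun w => ⟨_, h3 w 1⟩
    have hKtop : K = ⊤ := by
      rw [← Submodule.orthogonal_eq_bot_iff]
      by_contra hne
      refine hco ⟨Kᗮ, hne, ?_, ?_, ?_⟩
      · rintro _ ⟨x, hx, rfl⟩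
        rw [Submodule.mem_orthogonal]
        intro u hu
        rw [← LinearMap.adjoint_inner_left]
        exact (Submodule.mem_orthogonal _ _).mp hx _ (hK1 u hu)
      · rintro _ ⟨x, hx, rfl⟩
        rw [Submodule.mem_orthogonal]
        intro u hu
        rw [← LinearMap.adjoint_inner_left]
        exact (Submodule.mem_orthogonal _ _).mp hx _ (hK2 u hu)
      · intro x hx
        rw [LinearMap.mem_ker, ← inner_self_eq_zero (𝕜 := ℂ), ← LinearMap.adjoint_inner_left]
        exact (Submodule.mem_orthogonal _ _).mp hx _ (hKj _)
    intro y
    change y ∈ LinearMap.range αd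
    induction y using TensorProduct.induction_on with
    | zero => exact Submodule.zero_mem _
    | tmul v f =>
      have := hmul f v 1 ((hK v).mp (hKtop ▸ Submodule.mem_top))
      rwa [mul_one] at this
    | add x y hx hy => exact Submodule.add_mem _ hx hy
end

section
/- The matrix R̂ = P·R satisfies the Hecke relation R̂² = (p⁻¹ − p)·R̂ + 1, where 1 denotes the 4×4 identity matrix. -/
/-- The R-matrix of `GL(2)_q` (equation (8) of the paper), a 4×4 matrix indexed by pairs
`(i,j) ∈ {1,2}×{1,2}` in the order `(1,1),(1,2),(2,1),(2,2)`. -/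
noncomputable def heckeR {K : Type*} [Field K] (p q : K) :
    Matrix (Fin 2 × Fin 2) (Fin 2 × Fin 2) K :=
  Matrix.of fun a b =>
    if a = b then (if a.1 = a.2 then p⁻¹ else 1)
    else if a = ((0 : Fin 2), (1 : Fin 2)) ∧ b = ((1 : Fin 2), (0 : Fin 2)) then p⁻¹ - q
    else if a = ((1 : Fin 2), (0 : Fin 2)) ∧ b = ((0 : Fin 2), (1 : Fin 2)) then p⁻¹ - q⁻¹
    else 0

/-- The permutation (flip) matrix `P` with `P[(i,j),(k,l)] = 1` iff `(k,l) = (j,i)`. -/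
noncomputable def flipP {K : Type*} [Field K] :
    Matrix (Fin 2 × Fin 2) (Fin 2 × Fin 2) K :=
  Matrix.of fun a b => if b = (a.2, a.1) then 1 else 0

/-- The matrix `R̂ = P·R` satisfies the Hecke relation
`R̂² = (p⁻¹ − p)·R̂ + 1`, where `p = q` or `p = q⁻¹` and `q ≠ 0`. -/
theorem heckeR_hecke_relation {K : Type*} [Field K] (p q : K) (hq : q ≠ 0)
    (hp : p = q ∨ p = q⁻¹) :
    (flipP * heckeR p q) * (flipP * heckeR p q)
      = (p⁻¹ - p) • (flipP * heckeR p q) + 1 := by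
  have key : ∀ a b : Fin 2 × Fin 2,
      (flipP * heckeR p q : Matrix _ _ K) a b = heckeR p q (a.2, a.1) b := by
    intro a b
    simp [Matrix.mul_apply, flipP]
  ext ⟨i, j⟩ ⟨k, l⟩
  rw [Matrix.mul_apply, Matrix.add_apply, Matrix.smul_apply]
  simp only [key, Fintype.sum_prod_type, Fin.sum_univ_two, Matrix.one_apply]
  rcases hp with rfl | rfl <;>
  fin_cases i <;> fin_cases j <;> fin_cases k <;> fin_cases l <;>
    simp [heckeR] <;> field_simp <;> ring
end

section
/- Assume in addition that p + p⁻¹ ≠ 0, and set P⁺ = (p + p⁻¹)⁻¹·(R̂ + p·1) and P⁻ = (p + p⁻¹)⁻¹·(p⁻¹·1 − R̂), where R̂ = P·R and 1 is the 4×4 identity matrix. Then P⁺ + P⁻ = 1, (P⁺)² = P⁺ and (P⁻)² = P⁻. -/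
lemma hecke_rel {K : Type*} [Field K] (p q : K) (hq : q ≠ 0)
    (hp : p = q ∨ p = q⁻¹) :
    (flipP * heckeR p q) * (flipP * heckeR p q)
      = (p⁻¹ - p) • (flipP * heckeR p q)
        + (1 : Matrix (Fin 2 × Fin 2) (Fin 2 × Fin 2) K) := by
  have hM : ∀ a b : Fin 2 × Fin 2, (flipP * heckeR p q : Matrix (Fin 2 × Fin 2) (Fin 2 × Fin 2) K) a b = heckeR p q (a.2, a.1) b := by
    intro a b
    simp [Matrix.mul_apply, flipP]
  ext ⟨i, j⟩ ⟨k, l⟩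
  rw [Matrix.mul_apply, Matrix.add_apply, Matrix.smul_apply]
  simp only [hM, Fintype.sum_prod_type, Fin.sum_univ_two]
  rcases hp with rfl | rfl <;> fin_cases i <;> fin_cases j <;> fin_cases k <;> fin_cases l <;>
    simp [heckeR, Matrix.one_apply] <;> field_simp <;> ring

/-- Assume `q ≠ 0`, `p = q` or `p = q⁻¹`, and `p + p⁻¹ ≠ 0`. Set
`P⁺ = (p + p⁻¹)⁻¹·(R̂ + p·1)` and `P⁻ = (p + p⁻¹)⁻¹·(p⁻¹·1 − R̂)`, where `R̂ = P·R`.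
Then `P⁺ + P⁻ = 1`, `(P⁺)² = P⁺` and `(P⁻)² = P⁻`. -/
theorem heckeR_projectors {K : Type*} [Field K] (p q : K) (hq : q ≠ 0)
    (hp : p = q ∨ p = q⁻¹) (hpp : p + p⁻¹ ≠ 0) :
    ((p + p⁻¹)⁻¹ • (flipP * heckeR p q + p • (1 : Matrix (Fin 2 × Fin 2) (Fin 2 × Fin 2) K)))
        + ((p + p⁻¹)⁻¹ • (p⁻¹ • (1 : Matrix (Fin 2 × Fin 2) (Fin 2 × Fin 2) K)
            - flipP * heckeR p q)) = 1
    ∧ ((p + p⁻¹)⁻¹ • (flipP * heckeR p q + p • (1 : Matrix (Fin 2 × Fin 2) (Fin 2 × Fin 2) K)))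
        * ((p + p⁻¹)⁻¹ • (flipP * heckeR p q + p • (1 : Matrix (Fin 2 × Fin 2) (Fin 2 × Fin 2) K)))
      = ((p + p⁻¹)⁻¹ • (flipP * heckeR p q + p • (1 : Matrix (Fin 2 × Fin 2) (Fin 2 × Fin 2) K)))
    ∧ ((p + p⁻¹)⁻¹ • (p⁻¹ • (1 : Matrix (Fin 2 × Fin 2) (Fin 2 × Fin 2) K)
          - flipP * heckeR p q))
        * ((p + p⁻¹)⁻¹ • (p⁻¹ • (1 : Matrix (Fin 2 × Fin 2) (Fin 2 × Fin 2) K)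
            - flipP * heckeR p q))
      = ((p + p⁻¹)⁻¹ • (p⁻¹ • (1 : Matrix (Fin 2 × Fin 2) (Fin 2 × Fin 2) K)
          - flipP * heckeR p q)) := by
  have hp0 : p ≠ 0 := by
    rcases hp with rfl | rfl
    · exact hq
    · exact inv_ne_zero hq
  have H := hecke_rel p q hq hp
  generalize (flipP * heckeR p q) = M at H ⊢
  have h1 : p * p⁻¹ = 1 := mul_inv_cancel₀ hp0
  have h2 : (p + p⁻¹)⁻¹ * (p + p⁻¹) = 1 := inv_mul_cancel₀ hpp
  generalize (p + p⁻¹)⁻¹ = s at h2 ⊢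
  generalize p⁻¹ = r at *
  refine ⟨?_, ?_, ?_⟩
  · have : s • (M + p • (1 : Matrix (Fin 2 × Fin 2) (Fin 2 × Fin 2) K)) + s • (r • 1 - M)
        = (s * (p + r)) • 1 := by module
    rw [this, h2, one_smul]
  · rw [smul_mul_smul_comm, add_mul, mul_add, mul_add, H]
    simp only [smul_mul_assoc, mul_smul_comm, one_mul, mul_one]
    match_scalars
    · linear_combination s * h2
    · linear_combination s * p * h2 - s * s * h1
  · rw [smul_mul_smul_comm, sub_mul, mul_sub, mul_sub, H]
    simp only [smul_mul_assoc, mul_smul_comm, one_mul, mul_one]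
    match_scalars
    · linear_combination s * r * h2 - s * s * h1
    · linear_combination -s * h2
end

section
/- In the extended quantum group algebra A (generated by a,b,c,d,δ,ε with the relations listed in the context), set x₁₁ = δ·a, x₁₂ = s⁻¹·δ·b, x₂₁ = s·δ·c and x₂₂ = δ·d. Then the following identities hold in A: x₁₁x₁₂ = x₁₂x₁₁; x₂₁x₂₂ = x₂₂x₂₁; (x₁₁x₂₂ − x₂₂x₁₁) + (x₂₁x₁₂ − x₁₂x₂₁) = 0; x₁₁x₂₁ = q⁻²·x₂₁x₁₁; x₁₂x₂₂ = q⁻²·x₂₂x₁₂; x₂₁x₁₂ = q²·x₁₂x₂₁; and x₁₁x₂₂ − x₁₂x₂₁ = x₂₂x₁₁ − x₂₁x₁₂ = δ². -/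
/-- In the extended quantum group algebra `SL̃(2)_q` — any `K`-algebra `A` with elements
`a,b,c,d,δ,ε` satisfying the `SL(2)_q` relations together with the degree-operator relations
— set `x₁₁ = δ·a`, `x₁₂ = s⁻¹·δ·b`, `x₂₁ = s·δ·c`, `x₂₂ = δ·d` (where `q = s²`). Then:
`x₁₁x₁₂ = x₁₂x₁₁`; `x₂₁x₂₂ = x₂₂x₂₁`; `(x₁₁x₂₂ − x₂₂x₁₁) + (x₂₁x₁₂ − x₁₂x₂₁) = 0`;
`x₁₁x₂₁ = q⁻²·x₂₁x₁₁`; `x₁₂x₂₂ = q⁻²·x₂₂x₁₂`; `x₂₁x₁₂ = q²·x₁₂x₂₁`; and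
`x₁₁x₂₂ − x₁₂x₂₁ = x₂₂x₁₁ − x₂₁x₁₂ = δ²`. -/
theorem quantum_minkowski_coordinates
    {K : Type*} [Field K] (s q : K) (hs : s ≠ 0) (hq : q = s ^ 2)
    {A : Type*} [Ring A] [Algebra K A] (a b c d δ ε : A)
    (hab : a * b = q⁻¹ • (b * a))
    (hac : a * c = q⁻¹ • (c * a))
    (hbd : b * d = q⁻¹ • (d * b))
    (hcd : c * d = q⁻¹ • (d * c))
    (hbc : b * c = c * b)
    (hdet : a * d - q⁻¹ • (b * c) = 1)
    (hdet' : d * a - q • (c * b) = 1)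
    (hδε : δ * ε = 1) (hεδ : ε * δ = 1)
    (hδa : δ * a = a * δ)
    (hδb : δ * b = q • (b * δ))
    (hδc : δ * c = q⁻¹ • (c * δ))
    (hδd : δ * d = d * δ) :
    ∀ x₁₁ x₁₂ x₂₁ x₂₂ : A,
      x₁₁ = δ * a → x₁₂ = s⁻¹ • (δ * b) → x₂₁ = s • (δ * c) → x₂₂ = δ * d →
        x₁₁ * x₁₂ = x₁₂ * x₁₁
        ∧ x₂₁ * x₂₂ = x₂₂ * x₂₁
        ∧ (x₁₁ * x₂₂ - x₂₂ * x₁₁) + (x₂₁ * x₁₂ - x₁₂ * x₂₁) = 0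
        ∧ x₁₁ * x₂₁ = (q ^ 2)⁻¹ • (x₂₁ * x₁₁)
        ∧ x₁₂ * x₂₂ = (q ^ 2)⁻¹ • (x₂₂ * x₁₂)
        ∧ x₂₁ * x₁₂ = (q ^ 2) • (x₁₂ * x₂₁)
        ∧ x₁₁ * x₂₂ - x₁₂ * x₂₁ = δ ^ 2
        ∧ x₂₂ * x₁₁ - x₂₁ * x₁₂ = δ ^ 2 := by
  have hq0 : q ≠ 0 := by rw [hq]; exact pow_ne_zero 2 hs
  have hbδ : b * δ = q⁻¹ • (δ * b) := by rw [hδb, smul_smul, inv_mul_cancel₀ hq0, one_smul]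
  have hcδ : c * δ = q • (δ * c) := by rw [hδc, smul_smul, mul_inv_cancel₀ hq0, one_smul]
  have key : ∀ (u v : A) (k : K), u * δ = k • (δ * u) →
      (δ * u) * (δ * v) = k • (δ * δ * (u * v)) := by
    intro u v k h
    calc (δ * u) * (δ * v) = δ * (u * δ) * v := by simp only [mul_assoc]
      _ = _ := by rw [h]; simp only [mul_smul_comm, smul_mul_assoc, mul_assoc]
  have ka : ∀ v, (δ * a) * (δ * v) = δ * δ * (a * v) := fun v => by
    rw [key a v 1 (by rw [one_smul, hδa]), one_smul]
  have kd : ∀ v, (δ * d) * (δ * v) = δ * δ * (d * v) := fun v => by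
    rw [key d v 1 (by rw [one_smul, hδd]), one_smul]
  have kb : ∀ v, (δ * b) * (δ * v) = q⁻¹ • (δ * δ * (b * v)) := fun v => key b v _ hbδ
  have kc : ∀ v, (δ * c) * (δ * v) = q • (δ * δ * (c * v)) := fun v => key c v _ hcδ
  have had : a * d = 1 + q⁻¹ • (c * b) := by rw [← hdet, hbc]; abel
  have hda : d * a = 1 + q • (c * b) := by rw [← hdet']; abel
  rintro _ _ _ _ rfl rfl rfl rfl
  simp only [smul_mul_assoc, mul_smul_comm, ka, kb, kc, kd, hab, hac, hbd, hcd, hbc, had, hda,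
    smul_smul, mul_add, mul_one, pow_two δ]
  refine ⟨?_, ?_, ?_, ?_, ?_, ?_, ?_, ?_⟩
  all_goals first
    | trivial
    | (match_scalars <;> field_simp <;> done)
    | (match_scalars <;> field_simp <;> ring)
end

section
/- In the algebra A (the localization ℳ_{p,q}[D⁻¹] of the quantum compactified complexified Minkowski space, presented by the generators and relations listed in the context), the ordered monomials z₁₁ᵃ·z₁₂ᵇ·z₂₁ᶜ·z₂₂ᵈ·Dⁿ, where a,b,c,d range over the nonnegative integers and n ranges over the integers (with Dⁿ interpreted as E^(−n) when n < 0), form a basis of A as a K-vector space. -/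
/-- The defining relations of the localization `ℳ_{p,q}[D⁻¹]` of the quantum compactified
complexified Minkowski space, on the free algebra generated by six generators indexed as:
`0 ↦ z₁₁`, `1 ↦ z₁₂`, `2 ↦ z₂₁`, `3 ↦ z₂₂`, `4 ↦ D`, `5 ↦ E` (with `E = D⁻¹`). -/
inductive MinkRel {K : Type*} [Field K] (p q : K) :
    FreeAlgebra K (Fin 6) → FreeAlgebra K (Fin 6) → Prop
  | comm_z11_z12 : MinkRel p q
      (FreeAlgebra.ι K (0 : Fin 6) * FreeAlgebra.ι K (1 : Fin 6))
      (FreeAlgebra.ι K (1 : Fin 6) * FreeAlgebra.ι K (0 : Fin 6))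
  | comm_z11_z21 : MinkRel p q
      (FreeAlgebra.ι K (0 : Fin 6) * FreeAlgebra.ι K (2 : Fin 6))
      (FreeAlgebra.ι K (2 : Fin 6) * FreeAlgebra.ι K (0 : Fin 6))
  | comm_z12_z22 : MinkRel p q
      (FreeAlgebra.ι K (1 : Fin 6) * FreeAlgebra.ι K (3 : Fin 6))
      (FreeAlgebra.ι K (3 : Fin 6) * FreeAlgebra.ι K (1 : Fin 6))
  | comm_z21_z22 : MinkRel p q
      (FreeAlgebra.ι K (2 : Fin 6) * FreeAlgebra.ι K (3 : Fin 6))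
      (FreeAlgebra.ι K (3 : Fin 6) * FreeAlgebra.ι K (2 : Fin 6))
  | comm_z12_z21 : MinkRel p q
      (FreeAlgebra.ι K (1 : Fin 6) * FreeAlgebra.ι K (2 : Fin 6))
      (FreeAlgebra.ι K (2 : Fin 6) * FreeAlgebra.ι K (1 : Fin 6))
  | quadric : MinkRel p q
      (q⁻¹ • (FreeAlgebra.ι K (0 : Fin 6) * FreeAlgebra.ι K (3 : Fin 6)
        - FreeAlgebra.ι K (1 : Fin 6) * FreeAlgebra.ι K (2 : Fin 6)))
      (q • (FreeAlgebra.ι K (3 : Fin 6) * FreeAlgebra.ι K (0 : Fin 6)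
        - FreeAlgebra.ι K (1 : Fin 6) * FreeAlgebra.ι K (2 : Fin 6)))
  | D_z11 : MinkRel p q
      (FreeAlgebra.ι K (4 : Fin 6) * FreeAlgebra.ι K (0 : Fin 6))
      ((p * q⁻¹) • (FreeAlgebra.ι K (0 : Fin 6) * FreeAlgebra.ι K (4 : Fin 6)))
  | D_z12 : MinkRel p q
      (FreeAlgebra.ι K (4 : Fin 6) * FreeAlgebra.ι K (1 : Fin 6))
      ((p * q⁻¹) • (FreeAlgebra.ι K (1 : Fin 6) * FreeAlgebra.ι K (4 : Fin 6)))
  | D_z21 : MinkRel p q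
      (FreeAlgebra.ι K (4 : Fin 6) * FreeAlgebra.ι K (2 : Fin 6))
      ((p * q) • (FreeAlgebra.ι K (2 : Fin 6) * FreeAlgebra.ι K (4 : Fin 6)))
  | D_z22 : MinkRel p q
      (FreeAlgebra.ι K (4 : Fin 6) * FreeAlgebra.ι K (3 : Fin 6))
      ((p * q) • (FreeAlgebra.ι K (3 : Fin 6) * FreeAlgebra.ι K (4 : Fin 6)))
  | D_E : MinkRel p q
      (FreeAlgebra.ι K (4 : Fin 6) * FreeAlgebra.ι K (5 : Fin 6)) 1
  | E_D : MinkRel p q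
      (FreeAlgebra.ι K (5 : Fin 6) * FreeAlgebra.ι K (4 : Fin 6)) 1

/-- The localized quantum Minkowski algebra `A = ℳ_{p,q}[D⁻¹]`, presented by the
generators `z₁₁, z₁₂, z₂₁, z₂₂, D, E` and the relations `MinkRel p q`. -/
abbrev MinkAlg {K : Type*} [Field K] (p q : K) := RingQuot (MinkRel p q)

/-- The image of the `a`-th generator in `ℳ_{p,q}[D⁻¹]`. -/
noncomputable def minkGen {K : Type*} [Field K] (p q : K) (a : Fin 6) : MinkAlg p q :=
  RingQuot.mkAlgHom K (MinkRel p q) (FreeAlgebra.ι K a)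

/-- The ordered monomial `z₁₁^a · z₁₂^b · z₂₁^c · z₂₂^d · Dⁿ` (with `Dⁿ` interpreted as
`E^(−n)` when `n < 0`) in `ℳ_{p,q}[D⁻¹]`, indexed by `(a,b,c,d,n) ∈ ℕ×ℕ×ℕ×ℕ×ℤ`. -/
noncomputable def minkMonomial {K : Type*} [Field K] (p q : K) :
    ℕ × ℕ × ℕ × ℕ × ℤ → MinkAlg p q := fun m =>
  minkGen p q 0 ^ m.1 * minkGen p q 1 ^ m.2.1 * minkGen p q 2 ^ m.2.2.1 *
    minkGen p q 3 ^ m.2.2.2.1 *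
    (if 0 ≤ m.2.2.2.2 then minkGen p q 4 ^ m.2.2.2.2.toNat
     else minkGen p q 5 ^ (-m.2.2.2.2).toNat)

abbrev MinkIdx := ℕ × ℕ × ℕ × ℕ × ℤ

noncomputable def minkAct {K : Type*} [Field K] (p q : K) (i : Fin 6) (m : MinkIdx) :
    MinkIdx →₀ K :=
  match i, m with
  | 0, (a, b, c, d, n) => Finsupp.single (a + 1, b, c, d, n) 1
  | 1, (a, b, c, d, n) => Finsupp.single (a, b + 1, c, d, n) 1
  | 2, (a, b, c, d, n) => Finsupp.single (a, b, c + 1, d, n) 1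
  | 3, (a, b, c, d, n) => (q⁻¹ * q⁻¹) ^ a • Finsupp.single (a, b, c, d + 1, n) 1
      + (1 - (q⁻¹ * q⁻¹) ^ a) • Finsupp.single (a - 1, b + 1, c + 1, d, n) 1
  | 4, (a, b, c, d, n) =>
      ((p * q⁻¹) ^ (a + b) * (p * q) ^ (c + d)) • Finsupp.single (a, b, c, d, n + 1) 1
  | 5, (a, b, c, d, n) =>
      ((p * q⁻¹)⁻¹ ^ (a + b) * (p * q)⁻¹ ^ (c + d)) • Finsupp.single (a, b, c, d, n - 1) 1

noncomputable def minkOp {K : Type*} [Field K] (p q : K) (i : Fin 6) :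
    Module.End K (MinkIdx →₀ K) :=
  Finsupp.linearCombination K (minkAct p q i)

theorem minkOp_single {K : Type*} [Field K] (p q : K) (i : Fin 6) (m : MinkIdx) :
    minkOp p q i (Finsupp.single m 1) = minkAct p q i m := by
  simp [minkOp]

theorem minkOp_rel {K : Type*} [Field K] (p q : K) (hq : q ≠ 0) (hp : p ≠ 0)
    ⦃x y : FreeAlgebra K (Fin 6)⦄ (h : MinkRel p q x y) :
    FreeAlgebra.lift K (minkOp p q) x = FreeAlgebra.lift K (minkOp p q) y := by
  have key : ∀ f g : Module.End K (MinkIdx →₀ K),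
      (∀ a b c d n, f (Finsupp.single (a, b, c, d, n) 1) = g (Finsupp.single (a, b, c, d, n) 1)) →
      f = g := by
    intro f g h
    apply Finsupp.lhom_ext'
    rintro ⟨a, b, c, d, n⟩
    apply LinearMap.ext_ring
    simpa using h a b c d n
  apply key
  intro a b c d n
  cases h
  case quadric =>
    rcases a with _ | a
    · simp only [map_smul, map_sub, map_mul, FreeAlgebra.lift_ι_apply, Module.End.mul_apply,
        LinearMap.smul_apply, LinearMap.sub_apply, minkOp_single, minkAct, map_add,
        Nat.add_sub_cancel, pow_zero, sub_self, zero_smul, add_zero, one_smul, zero_add, pow_one]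
      match_scalars <;> field_simp <;> ring
    · simp only [map_smul, map_sub, map_mul, FreeAlgebra.lift_ι_apply, Module.End.mul_apply,
        LinearMap.smul_apply, LinearMap.sub_apply, minkOp_single, minkAct, map_add,
        Nat.add_sub_cancel, mul_pow, inv_pow]
      match_scalars <;> field_simp <;> ring
  all_goals
    simp only [map_smul, map_sub, map_mul, map_one, FreeAlgebra.lift_ι_apply, Module.End.mul_apply,
        LinearMap.smul_apply, LinearMap.sub_apply, minkOp_single, minkAct, map_add,
        Module.End.one_apply, smul_smul, smul_add, sub_add_cancel, add_sub_cancel_right]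
  case D_z22 =>
    rcases a with _ | a
    · simp only [pow_zero, sub_self, zero_smul, mul_zero, zero_mul, add_zero]
      match_scalars <;> field_simp <;> ring
    · simp only [Nat.add_sub_cancel]
      match_scalars <;> field_simp <;> ring
  all_goals
    try (match_scalars <;> simp only [mul_pow, inv_pow, mul_inv, inv_inv] <;> field_simp <;> ring)

noncomputable def minkRep {K : Type*} [Field K] (p q : K) (hq : q ≠ 0) (hp : p ≠ 0) :
    MinkAlg p q →ₐ[K] Module.End K (MinkIdx →₀ K) :=
  RingQuot.liftAlgHom K ⟨FreeAlgebra.lift K (minkOp p q), minkOp_rel p q hq hp⟩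

theorem minkRep_gen {K : Type*} [Field K] (p q : K) (hq : q ≠ 0) (hp : p ≠ 0) (i : Fin 6) :
    minkRep p q hq hp (minkGen p q i) = minkOp p q i := by
  simp [minkRep, minkGen]

theorem minkRep_monomial {K : Type*} [Field K] (p q : K) (hq : q ≠ 0) (hp : p ≠ 0)
    (m : MinkIdx) :
    minkRep p q hq hp (minkMonomial p q m) (Finsupp.single (0, 0, 0, 0, 0) 1)
      = Finsupp.single m 1 := by
  obtain ⟨a, b, c, d, n⟩ := m
  have h4 : ∀ k : ℕ, (minkOp p q 4 ^ k) (Finsupp.single (0, 0, 0, 0, 0) 1)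
      = Finsupp.single (0, 0, 0, 0, (k : ℤ)) 1 := by
    intro k
    induction k with
    | zero => simp
    | succ k ih => rw [pow_succ', Module.End.mul_apply, ih, minkOp_single]; simp [minkAct]
  have h5 : ∀ k : ℕ, (minkOp p q 5 ^ k) (Finsupp.single (0, 0, 0, 0, 0) 1)
      = Finsupp.single (0, 0, 0, 0, -(k : ℤ)) 1 := by
    intro k
    induction k with
    | zero => simp
    | succ k ih =>
      rw [pow_succ', Module.End.mul_apply, ih, minkOp_single]
      simp [minkAct, sub_eq_add_neg, add_comm]
  have h3 : ∀ k : ℕ, (minkOp p q 3 ^ k) (Finsupp.single (0, 0, 0, 0, n) 1)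
      = Finsupp.single (0, 0, 0, k, n) 1 := by
    intro k
    induction k with
    | zero => simp
    | succ k ih => rw [pow_succ', Module.End.mul_apply, ih, minkOp_single]; simp [minkAct]
  have h2 : ∀ k : ℕ, (minkOp p q 2 ^ k) (Finsupp.single (0, 0, 0, d, n) 1)
      = Finsupp.single (0, 0, k, d, n) 1 := by
    intro k
    induction k with
    | zero => simp
    | succ k ih => rw [pow_succ', Module.End.mul_apply, ih, minkOp_single]; simp [minkAct]
  have h1 : ∀ k : ℕ, (minkOp p q 1 ^ k) (Finsupp.single (0, 0, c, d, n) 1)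
      = Finsupp.single (0, k, c, d, n) 1 := by
    intro k
    induction k with
    | zero => simp
    | succ k ih => rw [pow_succ', Module.End.mul_apply, ih, minkOp_single]; simp [minkAct]
  have h0 : ∀ k : ℕ, (minkOp p q 0 ^ k) (Finsupp.single (0, b, c, d, n) 1)
      = Finsupp.single (k, b, c, d, n) 1 := by
    intro k
    induction k with
    | zero => simp
    | succ k ih => rw [pow_succ', Module.End.mul_apply, ih, minkOp_single]; simp [minkAct]
  have hn : (minkRep p q hq hp (if 0 ≤ n then minkGen p q 4 ^ n.toNat
      else minkGen p q 5 ^ (-n).toNat)) (Finsupp.single (0, 0, 0, 0, 0) 1)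
      = Finsupp.single (0, 0, 0, 0, n) 1 := by
    split_ifs with h
    · rw [map_pow, minkRep_gen, h4, Int.toNat_of_nonneg h]
    · rw [map_pow, minkRep_gen, h5, Int.toNat_of_nonneg (by lia), neg_neg]
  simp only [minkMonomial, map_mul, Module.End.mul_apply, hn]
  simp only [map_pow, minkRep_gen, h0, h1, h2, h3]

theorem minkRel_gen {K : Type*} [Field K] (p q : K) {x y : FreeAlgebra K (Fin 6)}
    (h : MinkRel p q x y) :
    RingQuot.mkAlgHom K (MinkRel p q) x = RingQuot.mkAlgHom K (MinkRel p q) y :=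
  RingQuot.mkAlgHom_rel K h

theorem qcomm_pow {K A : Type*} [Field K] [Ring A] [Algebra K A] {x y : A} {s : K}
    (h : x * y = s • (y * x)) (n : ℕ) : x * y ^ n = s ^ n • (y ^ n * x) := by
  induction n with
  | zero => simp
  | succ n ih =>
    rw [pow_succ y, ← mul_assoc, ih, smul_mul_assoc, mul_assoc, h, mul_smul_comm, smul_smul,
      mul_assoc, pow_succ]

theorem qcomm_inv {K A : Type*} [Field K] [Ring A] [Algebra K A] {x x' y : A} {s : K}
    (hs : s ≠ 0) (h1 : x * x' = 1) (h2 : x' * x = 1)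
    (h : x * y = s • (y * x)) : x' * y = s⁻¹ • (y * x') := by
  have : y * x' = s • (x' * y) := by
    calc y * x' = x' * (x * y) * x' := by rw [← mul_assoc x', h2, one_mul]
      _ = s • (x' * y) := by
        rw [h, mul_smul_comm, smul_mul_assoc, mul_assoc, mul_assoc, h1, mul_one]
  rw [this, smul_smul, inv_mul_cancel₀ hs, one_smul]

theorem qcomm_mono {K A : Type*} [Field K] [Ring A] [Algebra K A] {x z0 z1 z2 z3 : A} {s t : K}
    (h0 : x * z0 = s • (z0 * x)) (h1 : x * z1 = s • (z1 * x))
    (h2 : x * z2 = t • (z2 * x)) (h3 : x * z3 = t • (z3 * x)) (a b c d : ℕ) (w : A) :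
    x * (z0 ^ a * z1 ^ b * z2 ^ c * z3 ^ d * w) =
      (s ^ (a + b) * t ^ (c + d)) • (z0 ^ a * z1 ^ b * z2 ^ c * z3 ^ d * (x * w)) := by
  have e : ∀ {y : A} {r : K} (n : ℕ) (_ : x * y = r • (y * x)) (u : A),
      x * (y ^ n * u) = r ^ n • (y ^ n * (x * u)) := by
    intro y r n h u
    rw [← mul_assoc, qcomm_pow h, smul_mul_assoc, mul_assoc]
  simp only [mul_assoc, e a h0, e b h1, e c h2, e d h3, mul_smul_comm, smul_smul]
  congr 1
  ring

theorem z3_pow {K A : Type*} [Field K] [Ring A] [Algebra K A] {z0 z1 z2 z3 : A} {r : K}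
    (c1 : Commute z0 z1) (c2 : Commute z0 z2)
    (h : z3 * z0 = r • (z0 * z3) + (1 - r) • (z1 * z2)) (a : ℕ) :
    z3 * z0 ^ a = r ^ a • (z0 ^ a * z3) + (1 - r ^ a) • (z0 ^ (a - 1) * (z1 * z2)) := by
  induction a with
  | zero => simp
  | succ a ih =>
    have hc : z1 * z2 * z0 = z0 * (z1 * z2) := (c1.mul_right c2).eq.symm
    rw [pow_succ, ← mul_assoc, ih]
    rcases a with _ | a
    · simp [h]
    · simp only [Nat.add_sub_cancel, add_mul, smul_mul_assoc, mul_assoc, h, mul_add, mul_smul_comm]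
      rw [← mul_assoc z1, hc, pow_succ z0 a]
      simp only [mul_assoc]
      module

theorem minkGen_mul_monomial {K : Type*} [Field K] (p q : K) (hq : q ≠ 0) (hp : p ≠ 0)
    (i : Fin 6) (m : MinkIdx) :
    minkGen p q i * minkMonomial p q m =
      Finsupp.linearCombination K (minkMonomial p q) (minkAct p q i m) := by
  obtain ⟨a, b, c, d, n⟩ := m
  have r01 := minkRel_gen p q MinkRel.comm_z11_z12
  have r02 := minkRel_gen p q MinkRel.comm_z11_z21
  have r13 := minkRel_gen p q MinkRel.comm_z12_z22
  have r23 := minkRel_gen p q MinkRel.comm_z21_z22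
  have r12 := minkRel_gen p q MinkRel.comm_z12_z21
  have rq := minkRel_gen p q MinkRel.quadric
  have r40 := minkRel_gen p q MinkRel.D_z11
  have r41 := minkRel_gen p q MinkRel.D_z12
  have r42 := minkRel_gen p q MinkRel.D_z21
  have r43 := minkRel_gen p q MinkRel.D_z22
  have r45 := minkRel_gen p q MinkRel.D_E
  have r54 := minkRel_gen p q MinkRel.E_D
  simp only [map_mul, map_smul, map_sub, map_one] at r01 r02 r13 r23 r12 rq r40 r41 r42 r43 r45 r54
  simp only [← minkGen.eq_def] at r01 r02 r13 r23 r12 rq r40 r41 r42 r43 r45 r54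
  let u : (MinkAlg p q)ˣ := ⟨minkGen p q 4, minkGen p q 5, r45, r54⟩
  have hu : ∀ n : ℤ, (if 0 ≤ n then minkGen p q 4 ^ n.toNat
      else minkGen p q 5 ^ (-n).toNat) = ((u ^ n : (MinkAlg p q)ˣ) : MinkAlg p q) := by
    intro n
    split_ifs with h
    · conv_rhs => rw [← Int.toNat_of_nonneg h, zpow_natCast, Units.val_pow_eq_pow_val]
    · have : n = -((-n).toNat : ℤ) := by lia
      conv_rhs => rw [this, zpow_neg, zpow_natCast, ← inv_pow, Units.val_pow_eq_pow_val]
      rfl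
  have hu4 : ∀ n : ℤ, minkGen p q 4 * ((u ^ n : (MinkAlg p q)ˣ) : MinkAlg p q)
      = ((u ^ (n + 1) : (MinkAlg p q)ˣ) : MinkAlg p q) := by
    intro n
    rw [add_comm, zpow_one_add, Units.val_mul]
  have hu5 : ∀ n : ℤ, minkGen p q 5 * ((u ^ n : (MinkAlg p q)ˣ) : MinkAlg p q)
      = ((u ^ (n - 1) : (MinkAlg p q)ˣ) : MinkAlg p q) := by
    intro n
    rw [sub_eq_neg_add, zpow_add, zpow_neg_one, Units.val_mul]
    rfl
  have hm : ∀ a b c d n, minkMonomial p q (a, b, c, d, n) =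
      minkGen p q 0 ^ a * minkGen p q 1 ^ b * minkGen p q 2 ^ c * minkGen p q 3 ^ d *
        ((u ^ n : (MinkAlg p q)ˣ) : MinkAlg p q) := by
    intro a b c d n
    simp only [minkMonomial, hu]
  have hz : minkGen p q 3 * minkGen p q 0 = (q⁻¹ * q⁻¹) • (minkGen p q 0 * minkGen p q 3)
      + (1 - q⁻¹ * q⁻¹) • (minkGen p q 1 * minkGen p q 2) := by
    have := congrArg (fun x => q⁻¹ • x) rq
    simp only [smul_smul, inv_mul_cancel₀ hq, one_smul] at this
    rw [eq_sub_iff_add_eq] at this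
    rw [← this]
    module
  have s1 : p * q⁻¹ ≠ 0 := mul_ne_zero hp (inv_ne_zero hq)
  have s2 : p * q ≠ 0 := mul_ne_zero hp hq
  generalize hz0 : minkGen p q 0 = z0 at *
  generalize hz1 : minkGen p q 1 = z1 at *
  generalize hz2 : minkGen p q 2 = z2 at *
  generalize hz3 : minkGen p q 3 = z3 at *
  have c01 : Commute z0 z1 := r01
  have c02 : Commute z0 z2 := r02
  have c12 : Commute z1 z2 := r12
  have c13 : Commute z1 z3 := r13
  have c23 : Commute z2 z3 := r23
  have hl : ∀ m, Finsupp.linearCombination K (minkMonomial p q) (Finsupp.single m 1)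
      = minkMonomial p q m := by intro m; simp
  fin_cases i
  · simp only [minkAct, hl, hm, Fin.reduceFinMk, Fin.zero_eta]
    rw [pow_succ' z0, hz0]
    simp only [mul_assoc]
  · simp only [minkAct, hl, hm, Fin.reduceFinMk, Fin.mk_one]
    rw [pow_succ' z1, hz1]
    simp only [mul_assoc]
    rw [← mul_assoc, (c01.symm.pow_right a).eq]
    simp only [mul_assoc]
  · simp only [minkAct, hl, hm, Fin.reduceFinMk]
    rw [pow_succ' z2, hz2]
    simp only [mul_assoc]
    rw [← mul_assoc, (c02.symm.pow_right a).eq, mul_assoc, ← mul_assoc z2,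
      (c12.symm.pow_right b).eq]
    simp only [mul_assoc]
  · simp only [minkAct, hl, hm, Fin.reduceFinMk, map_add, map_smul]
    have e1 : ∀ w, z3 * (z1 ^ b * (z2 ^ c * w)) = z1 ^ b * (z2 ^ c * (z3 * w)) := by
      intro w
      rw [← mul_assoc, (c13.symm.pow_right b).eq, mul_assoc, ← mul_assoc z3,
        (c23.symm.pow_right c).eq, mul_assoc]
    have e2 : ∀ w, z1 * (z2 * (z1 ^ b * w)) = z1 ^ (b + 1) * (z2 * w) := by
      intro w
      rw [← mul_assoc z2, (c12.symm.pow_right b).eq, mul_assoc, ← mul_assoc, ← pow_succ']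
    simp only [mul_assoc]
    rw [hz3, ← mul_assoc z3, z3_pow c01 c02 hz, add_mul, smul_mul_assoc, smul_mul_assoc]
    simp only [mul_assoc]
    rw [e1, e2, pow_succ' z2, pow_succ' z3]
    simp only [mul_assoc]
  · simp only [minkAct, hl, hm, Fin.reduceFinMk, map_smul]
    rw [qcomm_mono r40 r41 r42 r43, hu4]
  · simp only [minkAct, hl, hm, Fin.reduceFinMk, map_smul]
    rw [qcomm_mono (qcomm_inv s1 r45 r54 r40) (qcomm_inv s1 r45 r54 r41)
      (qcomm_inv s2 r45 r54 r42) (qcomm_inv s2 r45 r54 r43), hu5]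

/-- In the algebra `ℳ_{p,q}[D⁻¹]` (with `q ≠ 0` and `p = q` or `p = q⁻¹`), the ordered
monomials `z₁₁^a · z₁₂^b · z₂₁^c · z₂₂^d · Dⁿ`, for `a,b,c,d ∈ ℕ` and `n ∈ ℤ`, form a
basis as a `K`-vector space. -/
theorem minkMonomial_isBasis {K : Type*} [Field K] (p q : K) (hq : q ≠ 0)
    (hp : p = q ∨ p = q⁻¹) :
    LinearIndependent K (minkMonomial p q)
      ∧ Submodule.span K (Set.range (minkMonomial p q)) = ⊤ := by
  have hp0 : p ≠ 0 := by
    rcases hp with rfl | rfl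
    · exact hq
    · exact inv_ne_zero hq
  constructor
  · let f : MinkAlg p q →ₗ[K] (MinkIdx →₀ K) :=
      (LinearMap.applyₗ (Finsupp.single ((0, 0, 0, 0, 0) : MinkIdx) (1 : K))).comp
        (minkRep p q hq hp0).toLinearMap
    apply LinearIndependent.of_comp f
    have : f ∘ minkMonomial p q = fun m => Finsupp.single m (1 : K) := by
      funext m
      exact minkRep_monomial p q hq hp0 m
    rw [this]
    exact Finsupp.linearIndependent_single_one K MinkIdx
  · set S := Submodule.span K (Set.range (minkMonomial p q)) with hS
    have hgen : ∀ i, ∀ y ∈ S, minkGen p q i * y ∈ S := by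
      intro i y hy
      induction hy using Submodule.span_induction with
      | mem x hx =>
        obtain ⟨m, rfl⟩ := hx
        rw [minkGen_mul_monomial p q hq hp0, hS, ← Finsupp.range_linearCombination]
        exact LinearMap.mem_range_self _ _
      | zero => simp
      | add x y _ _ hx hy => rw [mul_add]; exact S.add_mem hx hy
      | smul a x _ hx => rw [mul_smul_comm]; exact S.smul_mem _ hx
    have hall : ∀ x : FreeAlgebra K (Fin 6), ∀ y ∈ S,
        RingQuot.mkAlgHom K (MinkRel p q) x * y ∈ S := by
      intro x
      induction x using FreeAlgebra.induction with
      | grade0 r =>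
        intro y hy
        rw [AlgHom.commutes, ← Algebra.smul_def]
        exact S.smul_mem _ hy
      | grade1 i => exact hgen i
      | mul a b ha hb =>
        intro y hy
        rw [map_mul, mul_assoc]
        exact ha _ (hb _ hy)
      | add a b ha hb =>
        intro y hy
        rw [map_add, add_mul]
        exact S.add_mem (ha _ hy) (hb _ hy)
    have h1 : (1 : MinkAlg p q) ∈ S := by
      apply Submodule.subset_span
      exact ⟨(0, 0, 0, 0, 0), by simp [minkMonomial]⟩
    rw [eq_top_iff]
    intro x _
    obtain ⟨y, rfl⟩ := RingQuot.mkAlgHom_surjective K (MinkRel p q) x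
    simpa using hall y 1 h1
end
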